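/- arXiv:2405.10308 — 6 statements merged into one kernel-verified Lean document; each statement's English description precedes it below -/
import Mathlib

section
/- Let α be a finite type, ⊑ a preorder on α, and c : α → α a canonicalization with respect to the equivalence induced by ⊑. Then for every set F ⊆ α, the representation R_F = min {c(φ) | φ ∈ F} satisfies ↑R_F = ↑F, where ↑ denotes upward closure with respect to ⊑. (Theorem 3, antichain representation.) -/
/-- The minimal elements of `S` with respect to the relation `r`:
those `φ ∈ S` such that no `ψ ∈ S` with `ψ ⊑ φ` and `ψ ≠ φ`. -/
def minWrt {α : Type*} (r : α → α → Prop) (S : Set α) : Set α :=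
  {φ ∈ S | ∀ ψ ∈ S, r ψ φ → ψ = φ}

/-- The upward closure of `F` with respect to `r`. -/
def upClose {α : Type*} (r : α → α → Prop) (F : Set α) : Set α :=
  {ψ | ∃ φ ∈ F, r φ ψ}

/-- In a finite set on which a preorder is antisymmetric, every element lies above a minimal one. -/
theorem exists_mem_minWrt {α : Type*} {r : α → α → Prop} (hrefl : ∀ a, r a a)
    (htrans : ∀ a b c, r a b → r b c → r a c) {S : Set α} (hS : S.Finite)
    (hanti : ∀ a ∈ S, ∀ b ∈ S, r a b → r b a → a = b) {a : α} (ha : a ∈ S) :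
    ∃ m ∈ minWrt r S, r m a := by
  let _ : Preorder α := { le := r, le_refl := hrefl, le_trans := htrans }
  obtain ⟨m, hma, hm⟩ := hS.exists_le_minimal ha
  exact ⟨m, ⟨hm.1, fun b hb hbm => hanti b hb m hm.1 hbm (hm.2 hb hbm)⟩, hma⟩

theorem antichain_representation {α : Type*} [Fintype α] (r : α → α → Prop)
    (hrefl : Reflexive r) (htrans : Transitive r)
    (c : α → α)
    (hrep : ∀ φ, r (c φ) φ ∧ r φ (c φ))
    (hdec : ∀ φ ψ, (r φ ψ ∧ r ψ φ) ↔ c φ = c ψ)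
    (F : Set α) :
    upClose r (minWrt r (c '' F)) = upClose r F := by
  ext ψ
  constructor
  · rintro ⟨_, ⟨⟨φ, hφ, rfl⟩, -⟩, h⟩
    exact ⟨φ, hφ, htrans (hrep φ).2 h⟩
  · rintro ⟨φ, hφ, h⟩
    have hanti : ∀ a ∈ c '' F, ∀ b ∈ c '' F, r a b → r b a → a = b := by
      rintro _ ⟨a, -, rfl⟩ _ ⟨b, -, rfl⟩ hab hba
      exact (hdec a b).1 ⟨htrans (htrans (hrep a).2 hab) (hrep b).1,
        htrans (htrans (hrep b).2 hba) (hrep a).1⟩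
    obtain ⟨m, hm, hmφ⟩ := exists_mem_minWrt hrefl (fun _ _ _ => @htrans _ _ _)
      (Set.toFinite (c '' F)) hanti (Set.mem_image_of_mem c hφ)
    exact ⟨m, hm, htrans hmφ (htrans (hrep φ).1 h)⟩
end

section
/- Let α be a finite type, ⊑ a preorder on α, c : α → α a canonicalization with respect to the equivalence induced by ⊑, and Sat : α → Set S a map such that φ ⊑ ψ implies Sat φ ⊆ Sat ψ. Then for every set F ⊆ α, the representation R_F = min {c(φ) | φ ∈ F} satisfies ⋂_{φ ∈ R_F} Sat φ = ⋂_{φ ∈ F} Sat φ. (The semantic part of Theorem 3: the conjunction of the representation is equivalent to the conjunction of the original set.) -/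
/-- In a finite type, if equivalent elements of `T` are equal, then every element of `T`
lies above an element of `minWrt r T`. -/
theorem exists_mem_minWrt_of_mem {α : Type*} [Finite α] {r : α → α → Prop}
    (hrefl : ∀ a, r a a) (htrans : ∀ a b d, r a b → r b d → r a d) {T : Set α}
    (hanti : ∀ a ∈ T, ∀ b ∈ T, r a b → r b a → a = b) {a : α} (ha : a ∈ T) :
    ∃ m ∈ minWrt r T, r m a := by
  let _ : Preorder α := { le := r, le_refl := hrefl, le_trans := htrans }
  obtain ⟨m, hma, hm⟩ := T.toFinite.exists_le_minimal ha
  exact ⟨m, ⟨hm.prop, fun b hb hbm => hanti b hb m hm.prop hbm (hm.le_of_le hb hbm)⟩, hma⟩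

theorem representation_semantics {α S : Type*} [Fintype α] (r : α → α → Prop)
    (hrefl : Reflexive r) (htrans : Transitive r)
    (c : α → α)
    (hrep : ∀ φ, r (c φ) φ ∧ r φ (c φ))
    (hdec : ∀ φ ψ, (r φ ψ ∧ r ψ φ) ↔ c φ = c ψ)
    (Sat : α → Set S) (hmono : ∀ φ ψ, r φ ψ → Sat φ ⊆ Sat ψ)
    (F : Set α) :
    ⋂ φ ∈ minWrt r (c '' F), Sat φ = ⋂ φ ∈ F, Sat φ := by
  have hanti : ∀ a ∈ c '' F, ∀ b ∈ c '' F, r a b → r b a → a = b := by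
    rintro _ ⟨a, -, rfl⟩ _ ⟨b, -, rfl⟩ hab hba
    exact (hdec a b).1 ⟨htrans (hrep a).2 (htrans hab (hrep b).1),
      htrans (hrep b).2 (htrans hba (hrep a).1)⟩
  apply Set.Subset.antisymm
  · refine Set.subset_iInter₂ fun φ hφ => ?_
    obtain ⟨m, hm, hmφ⟩ := exists_mem_minWrt_of_mem hrefl (fun _ _ _ => @htrans _ _ _) hanti
      (Set.mem_image_of_mem c hφ)
    exact (Set.biInter_subset_of_mem hm).trans (hmono m φ (htrans hmφ (hrep φ).1))
  · refine Set.subset_iInter₂ ?_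
    rintro _ ⟨⟨φ, hφ, rfl⟩, -⟩
    exact (Set.biInter_subset_of_mem hφ).trans (hmono φ (c φ) (hrep φ).2)
end

section
/- Let α be a finite type, ⊑ a preorder on α, and c : α → α a canonicalization with respect to the equivalence induced by ⊑. Let F ⊆ α be upward-closed with representation R_F = min {c(φ) | φ ∈ F}, and let P₁, …, Pₙ ⊆ α be upward-closed sets. For a set R ⊆ α and upward-closed P define W_P(R) = min (⋃_{φ ∈ R} min {c(ψ) | φ ⊑ ψ and ψ ∈ P}). Then the iterated weakening W_{Pₙ}(⋯ W_{P₂}(W_{P₁}(R_F)) ⋯) equals min {c(φ) | φ ∈ F ∩ P₁ ∩ ⋯ ∩ Pₙ}, the representation of F ∩ P₁ ∩ ⋯ ∩ Pₙ. (Corollaries 5 and 6: weakening by a sequence of states computes the representation of F ⊔ α({s₁,…,sₙ}); with F = α it computes the representation of the abstraction α({s₁,…,sₙ}).) -/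
/-- Weakening a set `R` (a representation) with respect to an upward-closed set `P`:
replace each `φ ∈ R` by the minimal canonicalized formulas subsumed by `φ` lying in `P`,
and minimize the union. -/
def weakenBy {α : Type*} (r : α → α → Prop) (c : α → α) (R P : Set α) : Set α :=
  minWrt r (⋃ φ ∈ R, minWrt r (c '' {ψ | r φ ψ ∧ ψ ∈ P}))

theorem exists_minWrt_rel {α : Type*} [Finite α] {r : α → α → Prop} (hrefl : ∀ x, r x x)
    (htrans : ∀ ⦃x y z⦄, r x y → r y z → r x z) {S : Set α}
    (hanti : ∀ x ∈ S, ∀ y ∈ S, r x y → r y x → x = y) {x : α} (hx : x ∈ S) :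
    ∃ m ∈ minWrt r S, r m x := by
  let lt : α → α → Prop := fun a b => r a b ∧ ¬ r b a
  have : IsTrans α lt :=
    ⟨fun _ _ _ hab hbc => ⟨htrans hab.1 hbc.1, fun hca => hab.2 (htrans hbc.1 hca)⟩⟩
  have : Std.Irrefl lt := ⟨fun _ h => h.2 h.1⟩
  obtain ⟨m, ⟨hmS, hmx⟩, hmin⟩ :=
    (Finite.wellFounded_of_trans_of_irrefl lt).has_min {y | y ∈ S ∧ r y x} ⟨x, hx, hrefl x⟩
  refine ⟨m, ⟨hmS, fun y hy hym => hanti y hy m hmS hym ?_⟩, hmx⟩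
  by_contra hmy
  exact hmin y ⟨hy, htrans hym hmx⟩ ⟨hym, hmy⟩

theorem minWrt_eq_of_subset {α : Type*} [Finite α] {r : α → α → Prop} (hrefl : ∀ x, r x x)
    (htrans : ∀ ⦃x y z⦄, r x y → r y z → r x z) {S U : Set α}
    (hanti : ∀ x ∈ S, ∀ y ∈ S, r x y → r y x → x = y) (hSU : minWrt r S ⊆ U) (hUS : U ⊆ S) :
    minWrt r U = minWrt r S := by
  ext x
  constructor
  · rintro ⟨hxU, hmin⟩
    obtain ⟨m, hm, hmx⟩ := exists_minWrt_rel hrefl htrans hanti (hUS hxU)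
    exact hmin m (hSU hm) hmx ▸ hm
  · exact fun hx => ⟨hSU hx, fun y hy => hx.2 y (hUS hy)⟩

theorem weakenBy_minWrt_image {α : Type*} [Finite α] {r : α → α → Prop} (hrefl : ∀ x, r x x)
    (htrans : ∀ ⦃x y z⦄, r x y → r y z → r x z) {c : α → α} (hrep : ∀ φ, r (c φ) φ ∧ r φ (c φ))
    (hdec : ∀ φ ψ, (r φ ψ ∧ r ψ φ) ↔ c φ = c ψ) {G : Set α}
    (hG : ∀ φ ψ, φ ∈ G → r φ ψ → ψ ∈ G) (P : Set α) :
    weakenBy r c (minWrt r (c '' G)) P = minWrt r (c '' (G ∩ P)) := by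
  have hanti : ∀ T : Set α, ∀ x ∈ c '' T, ∀ y ∈ c '' T, r x y → r y x → x = y := by
    rintro T _ ⟨a, -, rfl⟩ _ ⟨b, -, rfl⟩ hab hba
    exact (hdec a b).1 ⟨htrans (hrep a).2 (htrans hab (hrep b).1),
      htrans (hrep b).2 (htrans hba (hrep a).1)⟩
  refine minWrt_eq_of_subset hrefl htrans (hanti _) ?_ ?_
  · rintro _ ⟨⟨ψ, ⟨hψG, hψP⟩, rfl⟩, hmin⟩
    obtain ⟨m, hm, hmψ⟩ :=
      exists_minWrt_rel hrefl htrans (hanti G) (Set.mem_image_of_mem c hψG)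
    refine Set.mem_biUnion hm ⟨⟨ψ, ⟨htrans hmψ (hrep ψ).1, hψP⟩, rfl⟩, ?_⟩
    rintro _ ⟨χ, ⟨hmχ, hχP⟩, rfl⟩
    obtain ⟨⟨φ, hφ, rfl⟩, -⟩ := hm
    exact hmin _ ⟨χ, ⟨hG φ χ hφ (htrans (hrep φ).2 hmχ), hχP⟩, rfl⟩
  · intro x hx
    obtain ⟨_, ⟨⟨φ, hφ, rfl⟩, -⟩, ⟨ψ, ⟨hφψ, hψP⟩, rfl⟩, -⟩ := Set.mem_iUnion₂.1 hx
    exact ⟨ψ, ⟨hG φ ψ hφ (htrans (hrep φ).2 hφψ), hψP⟩, rfl⟩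

theorem iterated_weaken {α : Type*} [Fintype α] (r : α → α → Prop)
    (hrefl : Reflexive r) (htrans : Transitive r)
    (c : α → α)
    (hrep : ∀ φ, r (c φ) φ ∧ r φ (c φ))
    (hdec : ∀ φ ψ, (r φ ψ ∧ r ψ φ) ↔ c φ = c ψ)
    (F : Set α) (hF : ∀ φ ψ, φ ∈ F → r φ ψ → ψ ∈ F)
    (Ps : List (Set α))
    (hPs : ∀ P ∈ Ps, ∀ φ ψ, φ ∈ P → r φ ψ → ψ ∈ P) :
    Ps.foldl (weakenBy r c) (minWrt r (c '' F))
      = minWrt r (c '' {φ | φ ∈ F ∧ ∀ P ∈ Ps, φ ∈ P}) := by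
  induction Ps generalizing F with
  | nil => simp
  | cons P Ps ih =>
    rw [List.foldl_cons, weakenBy_minWrt_image hrefl htrans hrep hdec hF,
      ih (F ∩ P)
        (fun φ ψ hφ h => ⟨hF φ ψ hφ.1 h, hPs P List.mem_cons_self φ ψ hφ.2 h⟩)
        (fun Q hQ => hPs Q (List.mem_cons_of_mem P hQ))]
    simp only [Set.mem_inter_iff, List.forall_mem_cons, and_assoc]
end

section
/- Let α and β be finite partially ordered types, let P_α ⊆ α and P_β ⊆ β be upward-closed, and equip α × β with the product order. Let P = {(a,b) | a ∈ P_α or b ∈ P_β}, and fix (a₀,b₀) with a₀ ∉ P_α and b₀ ∉ P_β. Then the set of minimal elements of {(a,b) | a₀ ≤ a, b₀ ≤ b, (a,b) ∈ P} equals {(a, b₀) | a is minimal in {a | a₀ ≤ a and a ∈ P_α}} ∪ {(a₀, b) | b is minimal in {b | b₀ ≤ b and b ∈ P_β}}. (This is the binary-disjunction case of Theorem 4: weakening φ₁ ∨ φ₂ for a state that satisfies neither disjunct is achieved by minimally weakening exactly one of the two disjuncts.) -/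
/-- The minimal elements of a subset of a partially ordered type. -/
def minSet {α : Type*} [PartialOrder α] (S : Set α) : Set α :=
  {x ∈ S | ∀ y ∈ S, y ≤ x → y = x}

theorem weaken_binary_or {α β : Type*} [PartialOrder α] [PartialOrder β]
    [Fintype α] [Fintype β]
    (Pa : Set α) (Pb : Set β)
    (hPa : ∀ a b : α, a ∈ Pa → a ≤ b → b ∈ Pa)
    (hPb : ∀ a b : β, a ∈ Pb → a ≤ b → b ∈ Pb)
    (a₀ : α) (b₀ : β) (ha : a₀ ∉ Pa) (hb : b₀ ∉ Pb) :
    minSet {p : α × β | a₀ ≤ p.1 ∧ b₀ ≤ p.2 ∧ (p.1 ∈ Pa ∨ p.2 ∈ Pb)}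
      = {p : α × β | p.1 ∈ minSet {a | a₀ ≤ a ∧ a ∈ Pa} ∧ p.2 = b₀}
        ∪ {p : α × β | p.1 = a₀ ∧ p.2 ∈ minSet {b | b₀ ≤ b ∧ b ∈ Pb}} := by
  ext ⟨a, b⟩
  simp only [minSet, Set.mem_ofPred_eq, Set.mem_union]
  constructor
  · rintro ⟨⟨hle₁, hle₂, hP | hP⟩, hmin⟩
    · have hb_eq : b = b₀ :=
        (congrArg Prod.snd (hmin (a, b₀) ⟨hle₁, le_rfl, Or.inl hP⟩ ⟨le_rfl, hle₂⟩)).symm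
      exact Or.inl ⟨⟨⟨hle₁, hP⟩, fun c hc hca =>
        congrArg Prod.fst (hmin (c, b) ⟨hc.1, hle₂, Or.inl hc.2⟩ ⟨hca, le_rfl⟩)⟩, hb_eq⟩
    · have ha_eq : a = a₀ :=
        (congrArg Prod.fst (hmin (a₀, b) ⟨le_rfl, hle₂, Or.inr hP⟩ ⟨hle₁, le_rfl⟩)).symm
      exact Or.inr ⟨ha_eq, ⟨hle₂, hP⟩, fun d hd hdb =>
        congrArg Prod.snd (hmin (a, d) ⟨hle₁, hd.1, Or.inr hd.2⟩ ⟨le_rfl, hdb⟩)⟩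
  · rintro (⟨⟨⟨hle, hP⟩, hmin⟩, rfl⟩ | ⟨rfl, ⟨hle, hP⟩, hmin⟩)
    · refine ⟨⟨hle, le_rfl, Or.inl hP⟩, ?_⟩
      rintro ⟨c, d⟩ ⟨hc, hd, hcd⟩ ⟨hca, hdb⟩
      obtain rfl : d = b := le_antisymm hdb hd
      exact Prod.ext (hmin c ⟨hc, hcd.resolve_right hb⟩ hca) rfl
    · refine ⟨⟨le_rfl, hle, Or.inr hP⟩, ?_⟩
      rintro ⟨c, d⟩ ⟨hc, hd, hcd⟩ ⟨hca, hdb⟩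
      obtain rfl : c = a := le_antisymm hca hc
      exact Prod.ext rfl (hmin d ⟨hd, hcd.resolve_left ha⟩ hdb)
end

section
/- Let α be a finite partially ordered type with order ⊑ and let P ⊆ α be upward-closed. For finite sets A, B ⊆ α write A ⊑∧ B iff every b ∈ B has some a ∈ A with a ⊑ b. Let A ⊆ α be a finite set and define B* = min (⋃_{a ∈ A} min {p ∈ P | a ⊑ p}). Then: (1) A ⊑∧ B*; (2) B* ⊆ P; and (3) for every finite set B with A ⊑∧ B and B ⊆ P, we have B* ⊑∧ B. (This is the unbounded-conjunction case of Theorem 4: the weakening of a conjunction ⋀A with respect to a state is the single conjunction collecting the minimal weakenings of all conjuncts, and it subsumes every conjunction that is subsumed by ⋀A and satisfied by the state.) -/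
/-- The weakening of a conjunction `⋀ A` with respect to an upward-closed set `P`:
the set collecting the minimal weakenings of all conjuncts, minimized. -/
def weakenConj {α : Type*} [PartialOrder α] (P : Set α) (A : Finset α) : Set α :=
  minSet (⋃ a ∈ A, minSet {p | p ∈ P ∧ a ≤ p})

/-- In a finite partial order every element of a set lies above a minimal element of it. -/
theorem exists_mem_minSet_le {α : Type*} [PartialOrder α] [Finite α] {S : Set α} {x : α}
    (hx : x ∈ S) : ∃ m ∈ minSet S, m ≤ x := by
  obtain ⟨m, hmx, hm⟩ := S.toFinite.exists_le_minimal hx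
  exact ⟨m, ⟨hm.prop, fun _ hy hym => hm.eq_of_le hy hym⟩, hmx⟩

theorem mem_of_mem_weakenConj {α : Type*} [PartialOrder α] {P : Set α} {A : Finset α} {b : α}
    (hb : b ∈ weakenConj P A) : b ∈ P ∧ ∃ a ∈ A, a ≤ b := by
  obtain ⟨a, ha, hab⟩ := Set.mem_iUnion₂.1 hb.1
  exact ⟨hab.1.1, a, ha, hab.1.2⟩

theorem weaken_unbounded_conj {α : Type*} [PartialOrder α] [Fintype α]
    (P : Set α) (hP : ∀ a b : α, a ∈ P → a ≤ b → b ∈ P) (A : Finset α) :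
    (∀ b ∈ weakenConj P A, ∃ a ∈ A, a ≤ b) ∧
    weakenConj P A ⊆ P ∧
    (∀ B : Finset α, (∀ b ∈ B, ∃ a ∈ A, a ≤ b) → (↑B : Set α) ⊆ P →
      ∀ b ∈ B, ∃ a ∈ weakenConj P A, a ≤ b) := by
  refine ⟨fun b hb => (mem_of_mem_weakenConj hb).2, fun b hb => (mem_of_mem_weakenConj hb).1,
    fun B hAB hBP b hb => ?_⟩
  obtain ⟨a, ha, hab⟩ := hAB b hb
  obtain ⟨p, hp, hpb⟩ := exists_mem_minSet_le (S := {p | p ∈ P ∧ a ≤ p}) ⟨hBP hb, hab⟩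
  obtain ⟨m, hm, hmp⟩ := exists_mem_minSet_le (Set.mem_biUnion (s := (A : Set α))
    (t := fun a => minSet {p | p ∈ P ∧ a ≤ p}) ha hp)
  exact ⟨m, hm, hmp.trans hpb⟩
end

section
/- Let X, Y, Z be types and let φ : X → Z → Y → Prop, ψ₁ : X → Z → Y → Prop, and ψ₂ : X → Prop. Then (∃ f : X → Z → Y, ∀ x z, φ x z (f x z) ∨ (ψ₁ x z (f x z) ∧ ψ₂ x)) holds if and only if both (∃ f : X → Z → Y, ∀ x z, φ x z (f x z) ∨ ψ₁ x z (f x z)) and (∃ f : X → Z → Y, ∀ x z, φ x z (f x z) ∨ ψ₂ x) hold. (This is the second-order, Skolemized formulation of Lemma 1: a quantified formula ∀x̄ Q̄ȳ. φ ∨ (ψ₁ ∧ ψ₂(x̄)), where ψ₂ depends only on the leading universally quantified variables, is equivalent to the conjunction of the two formulas obtained by splitting the cube ψ₁ ∧ ψ₂.) -/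
theorem cube_decomposition {X Y Z : Type*}
    (φ ψ₁ : X → Z → Y → Prop) (ψ₂ : X → Prop) :
    (∃ f : X → Z → Y, ∀ x z, φ x z (f x z) ∨ (ψ₁ x z (f x z) ∧ ψ₂ x)) ↔
      ((∃ f : X → Z → Y, ∀ x z, φ x z (f x z) ∨ ψ₁ x z (f x z)) ∧
        (∃ f : X → Z → Y, ∀ x z, φ x z (f x z) ∨ ψ₂ x)) := by
  constructor
  · rintro ⟨f, hf⟩
    exact ⟨⟨f, fun x z => (hf x z).imp_right And.left⟩,
      ⟨f, fun x z => (hf x z).imp_right And.right⟩⟩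
  · rintro ⟨⟨f, hf⟩, ⟨g, hg⟩⟩
    classical
    refine ⟨fun x => if ψ₂ x then f x else g x, fun x z => ?_⟩
    by_cases h : ψ₂ x
    · simpa [h] using hf x z
    · simpa [h] using hg x z
end
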